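/- arXiv:2209.05811 — 2 statements merged into one kernel-verified Lean document; each statement's English description precedes it below -/
import Mathlib

section
/- Let X be a median graph of dimension at most D and staircase length at most σ (D, σ natural numbers). Then for all vertices x, y of X, every vertex m ∈ [x,y], and every l ≥ 1, the number of H-segments of length l that are contained in [x,y]_H and have m in their interior is at most (l−1)·σ·D^l. -/
open scoped BigOperators

namespace MedianQM

variable {V : Type*}

/-- The interval `[x,y]`: vertices on geodesics from `x` to `y`. -/
def interval (X : SimpleGraph V) (x y : V) : Set V :=
  {m | X.dist x m + X.dist m y = X.dist x y}

/-- A median graph: connected, and any three vertices admit a unique median. -/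
def IsMedianGraph (X : SimpleGraph V) : Prop :=
  X.Connected ∧ ∀ x y z : V, ∃! m : V,
    m ∈ interval X x y ∧ m ∈ interval X y z ∧ m ∈ interval X x z

/-- A halfspace of `X`: the set of vertices strictly closer to one endpoint of
an edge than to the other. -/
def IsHalfspace (X : SimpleGraph V) (h : Set V) : Prop :=
  ∃ a b : V, X.Adj a b ∧ h = {v | X.dist v a < X.dist v b}

/-- The edge `{a,b}` is dual to the halfspace `h` (equivalently, to the
hyperplane `{h, h̄}`). -/
def EdgeDual (X : SimpleGraph V) (h : Set V) (a b : V) : Prop :=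
  X.Adj a b ∧
    (h = {v | X.dist v a < X.dist v b} ∨ h = {v | X.dist v b < X.dist v a})

/-- Two halfspaces are transverse. -/
def Transv (h k : Set V) : Prop :=
  (h ∩ k).Nonempty ∧ (hᶜ ∩ k).Nonempty ∧ (h ∩ kᶜ).Nonempty ∧ (hᶜ ∩ kᶜ).Nonempty

/-- `[x,y]_H`: the set of halfspaces separating `y` from `x`. -/
def sepH (X : SimpleGraph V) (x y : V) : Set (Set V) :=
  {h | IsHalfspace X h ∧ y ∈ h ∧ x ∉ h}

/-- `X` has dimension at most `D`: every (finite) family of pairwise transverse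
halfspaces has at most `D` elements. -/
def DimLE (X : SimpleGraph V) (D : ℕ) : Prop :=
  ∀ S : Finset (Set V), (∀ h ∈ S, IsHalfspace X h) →
    (∀ h ∈ S, ∀ k ∈ S, h ≠ k → Transv h k) → S.card ≤ D

/-- `h ⊋ k` are tightly nested: no halfspace lies strictly between them. -/
def TightlyNested (X : SimpleGraph V) (h k : Set V) : Prop :=
  k ⊂ h ∧ ¬ ∃ h' : Set V, IsHalfspace X h' ∧ h' ⊂ h ∧ k ⊂ h'

/-- A staircase of length `n`. -/
def IsStaircase (X : SimpleGraph V) (n : ℕ) (h k : Fin n → Set V) : Prop :=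
  (∀ i, IsHalfspace X (h i)) ∧ (∀ i, IsHalfspace X (k i)) ∧
  (∀ i j : Fin n, i < j → h j ⊂ h i) ∧ (∀ i j : Fin n, i < j → k j ⊂ k i) ∧
  (∀ i, k i ⊂ h i) ∧ (∀ i j : Fin n, j < i → Transv (h i) (k j))

/-- `X` has staircase length at most `σ`: there is no staircase of length `σ+1`. -/
def StaircaseLE (X : SimpleGraph V) (σ : ℕ) : Prop :=
  ∀ h k : Fin (σ + 1) → Set V, ¬ IsStaircase X (σ + 1) h k

/-- An `H`-segment of length `l`: a tuple of consecutively tightly nested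
halfspaces `h₁ ⊋ ⋯ ⊋ h_l`. -/
def IsHSegment (X : SimpleGraph V) (l : ℕ) (s : Fin l → Set V) : Prop :=
  (∀ i, IsHalfspace X (s i)) ∧
  ∀ i j : Fin l, (j : ℕ) = (i : ℕ) + 1 → TightlyNested X (s i) (s j)

/-- The segment `t` is contained in `[x,y]_H`. -/
def SegIn (X : SimpleGraph V) (x y : V) {l : ℕ} (t : Fin l → Set V) : Prop :=
  ∀ i, t i ∈ sepH X x y

/-- The translate of a segment by a group element. -/
def segSMul {Γ : Type*} [SMul Γ V] (γ : Γ) {l : ℕ} (s : Fin l → Set V) :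
    Fin l → Set V :=
  fun i => (γ • ·) '' s i

/-- The set of translates of `s` contained in `[x,y]_H`. -/
def translatesIn (X : SimpleGraph V) (Γ : Type*) [SMul Γ V] {l : ℕ}
    (s : Fin l → Set V) (x y : V) : Set (Fin l → Set V) :=
  {t | (∃ γ : Γ, t = segSMul γ s) ∧ SegIn X x y t}

/-- The median quasimorphism of the segment `s` (for the action of `Γ` on `X`). -/
noncomputable def fs (X : SimpleGraph V) (Γ : Type*) [SMul Γ V] {l : ℕ}
    (s : Fin l → Set V) (x y : V) : ℝ :=
  ((translatesIn X Γ s x y).ncard : ℝ) - ((translatesIn X Γ s y x).ncard : ℝ)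

/-- The coboundary of a function of two variables, evaluated on a triple. -/
noncomputable def d1 (f : V → V → ℝ) (x y z : V) : ℝ := f y z - f x z + f x y

/-- The simplicial coboundary operator. -/
noncomputable def cob {W : Type*} {m : ℕ} (β : (Fin (m + 1) → W) → ℝ) :
    (Fin (m + 2) → W) → ℝ :=
  fun x => ∑ j : Fin (m + 2), (-1 : ℝ) ^ (j : ℕ) * β (fun i => x (j.succAbove i))

/-- Γ-invariance of a cochain. -/
def IsInvariant (Γ : Type*) {W : Type*} [SMul Γ W] {m : ℕ}
    (β : (Fin m → W) → ℝ) : Prop :=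
  ∀ (γ : Γ) (x : Fin m → W), β (fun i => γ • x i) = β x

/-- Boundedness of a real-valued function. -/
def IsBounded {α : Type*} (β : α → ℝ) : Prop := ∃ C : ℝ, ∀ x, |β x| ≤ C

/-- A head of the segment `s`. -/
def IsHead (X : SimpleGraph V) {l : ℕ} (hl : 0 < l) (s : Fin l → Set V)
    (a : V) : Prop :=
  a ∉ s ⟨0, hl⟩ ∧ ∃ b, EdgeDual X (s ⟨0, hl⟩) a b

/-- A tail of the segment `s`. -/
def IsTail (X : SimpleGraph V) {l : ℕ} (hl : 0 < l) (s : Fin l → Set V)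
    (a : V) : Prop :=
  a ∈ s ⟨l - 1, by omega⟩ ∧ ∃ b, EdgeDual X (s ⟨l - 1, by omega⟩) a b

/-- The cochain `κ` is non-transverse to the segment `s`. -/
def NonTransverseTo (X : SimpleGraph V) {n l : ℕ} (hl : 0 < l)
    (κ : (Fin (n + 1) → V) → ℝ) (s : Fin l → Set V) : Prop :=
  (∀ (x : Fin n → V) (a a' : V), IsHead X hl s a → IsHead X hl s a' →
    κ (Fin.cons a x) = κ (Fin.cons a' x)) ∧
  (∀ (x : Fin n → V) (a a' : V), IsTail X hl s a → IsTail X hl s a' →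
    κ (Fin.cons a x) = κ (Fin.cons a' x))

/-- The action of `Γ` on `X` is by graph automorphisms. -/
def ActsOn (Γ : Type*) [SMul Γ V] (X : SimpleGraph V) : Prop :=
  ∀ (γ : Γ) (a b : V), X.Adj a b → X.Adj (γ • a) (γ • b)


/-- **Dilworth's theorem** for a finite subset of a partial order: if antichains have at most `n`
elements, then the set is covered by `n` chains (the colour classes of `c`). -/
theorem exists_chain_coloring {α : Type*} [PartialOrder α] (S : Finset α) :
    ∀ n : ℕ, (∀ A ⊆ S, IsAntichain (· ≤ ·) (A : Set α) → A.card ≤ n) →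
      ∃ c : α → ℕ, (∀ a ∈ S, c a < n) ∧ ∀ a ∈ S, ∀ b ∈ S, c a = c b → a ≤ b ∨ b ≤ a := by
  classical
  induction S using Finset.strongInduction with
  | H S ih =>
  intro n hn
  obtain rfl | hS := S.eq_empty_or_nonempty
  · exact ⟨fun _ => 0, by simp, by simp⟩
  obtain ⟨a, haS, hmax⟩ := S.exists_maximal hS
  set S' := S.erase a
  have hsub : S' ⊆ S := S.erase_subset a
  obtain ⟨A₀, hA₀, hA₀max⟩ := Finset.exists_max_image
    (S'.powerset.filter fun A : Finset α => IsAntichain (· ≤ ·) (A : Set α)) Finset.card ⟨∅, by simp⟩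
  simp only [Finset.mem_filter, Finset.mem_powerset, and_imp] at hA₀ hA₀max
  set k := A₀.card
  have hkn : k ≤ n := hn _ (hA₀.1.trans hsub) hA₀.2
  obtain ⟨c, hck, hc⟩ := ih S' (Finset.erase_ssubset haS) k hA₀max
  have hsurj : ∀ A ⊆ S', IsAntichain (· ≤ ·) (A : Set α) → A.card = k →
      ∀ i < k, ∃ z ∈ A, c z = i := by
    intro A hA hanti hcard i hi
    have hinj : Set.InjOn c A := by
      intro u hu v hv huv
      obtain h | h := hc u (hA hu) v (hA hv) huv
      · exact hanti.eq hu hv h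
      · exact (hanti.eq hv hu h).symm
    have himg : A.image c = Finset.range k := by
      apply Finset.eq_of_subset_of_card_le
      · intro j hj
        obtain ⟨z, hz, rfl⟩ := Finset.mem_image.1 hj
        exact Finset.mem_range.2 (hck z (hA hz))
      · rw [Finset.card_image_of_injOn hinj, hcard, Finset.card_range]
    exact Finset.mem_image.1 (himg ▸ Finset.mem_range.2 hi)
  have htop : ∀ i < k, ∃ z, c z = i ∧
      (∃ A ⊆ S', IsAntichain (· ≤ ·) (A : Set α) ∧ A.card = k ∧ z ∈ A) ∧
      ∀ A ⊆ S', IsAntichain (· ≤ ·) (A : Set α) → A.card = k →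
        ∀ w ∈ A, c w = i → w ≤ z := by
    intro i hi
    obtain ⟨z₀, hz₀, hcz₀⟩ := hsurj A₀ hA₀.1 hA₀.2 rfl i hi
    obtain ⟨z, hz, hzmax⟩ := (S'.filter fun z => c z = i ∧
      ∃ A ⊆ S', IsAntichain (· ≤ ·) (A : Set α) ∧ A.card = k ∧ z ∈ A).exists_maximal
      ⟨z₀, Finset.mem_filter.2 ⟨hA₀.1 hz₀, hcz₀, A₀, hA₀.1, hA₀.2, rfl, hz₀⟩⟩
    rw [Finset.mem_filter] at hz
    refine ⟨z, hz.2.1, hz.2.2, fun A hA hanti hcard w hw hcw => ?_⟩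
    obtain h | h := hc w (hA hw) z hz.1 (hcw.trans hz.2.1.symm)
    · exact h
    · exact hzmax (Finset.mem_filter.2 ⟨hA hw, hcw, A, hA, hanti, hcard, hw⟩) h
  have : Nonempty α := ⟨a⟩
  choose! x hxc hxA hxtop using htop
  have hxS' : ∀ i < k, x i ∈ S' := fun i hi => by
    obtain ⟨A, hA, -, -, hz⟩ := hxA i hi
    exact hA hz
  by_cases hcase : ∃ i < k, x i ≤ a
  · obtain ⟨i, hi, hxa⟩ := hcase
    set K := insert a (S'.filter fun z => c z = i ∧ z ≤ x i) with hK
    have hKchain : ∀ u ∈ K, ∀ v ∈ K, u ≤ v ∨ v ≤ u := by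
      intro u hu v hv
      simp only [hK, Finset.mem_insert, Finset.mem_filter] at hu hv
      obtain rfl | ⟨hu, hcu, hux⟩ := hu
      · obtain rfl | ⟨hv, hcv, hvx⟩ := hv
        · exact Or.inl le_rfl
        · exact Or.inr (hvx.trans hxa)
      · obtain rfl | ⟨hv, hcv, hvx⟩ := hv
        · exact Or.inl (hux.trans hxa)
        · exact hc u hu v hv (hcu.trans hcv.symm)
    have hrest : S \ K ⊆ S' := fun z hz => by
      rw [Finset.mem_sdiff] at hz
      exact Finset.mem_erase.2 ⟨fun h => hz.2 (h ▸ Finset.mem_insert_self _ _), hz.1⟩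
    obtain ⟨c', hc'k, hc'⟩ := ih (S \ K) ((Finset.ssubset_iff_of_subset Finset.sdiff_subset).2
        ⟨a, haS, fun h => (Finset.mem_sdiff.1 h).2 (Finset.mem_insert_self _ _)⟩) (k - 1) (by
      intro A hA hanti
      by_contra! hlt
      have hle := hA₀max A (hA.trans hrest) hanti
      have hcard : A.card = k := by omega
      obtain ⟨z, hz, hcz⟩ := hsurj A (hA.trans hrest) hanti hcard i hi
      exact (Finset.mem_sdiff.1 (hA hz)).2 (Finset.mem_insert_of_mem (Finset.mem_filter.2
        ⟨hrest (hA hz), hcz, hxtop i hi A (hA.trans hrest) hanti hcard z hz hcz⟩)))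
    have hlt : ∀ u ∈ S, u ∉ K → c' u < k - 1 := fun u hu huK =>
      hc'k u (Finset.mem_sdiff.2 ⟨hu, huK⟩)
    refine ⟨fun z => if z ∈ K then k - 1 else c' z, fun u hu => ?_, fun u hu v hv huv => ?_⟩
    · have := hlt u hu
      dsimp only
      split_ifs with huK
      · omega
      · have := this huK
        omega
    · by_cases huK : u ∈ K <;> by_cases hvK : v ∈ K <;>
          simp only [huK, hvK, if_true, if_false] at huv
      · exact hKchain u huK v hvK
      · exact absurd huv (hlt v hv hvK).ne'
      · exact absurd huv (hlt u hu huK).ne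
      · exact hc' u (Finset.mem_sdiff.2 ⟨hu, huK⟩) v (Finset.mem_sdiff.2 ⟨hv, hvK⟩) huv
  · push Not at hcase
    have hxinj : Set.InjOn x ((Finset.range k : Finset ℕ) : Set ℕ) := by
      intro i hi j hj hij
      simp only [Finset.coe_range, Set.mem_Iio] at hi hj
      rw [← hxc i hi, ← hxc j hj, hij]
    have hanti : IsAntichain (· ≤ ·)
        ((insert a ((Finset.range k).image x) : Finset α) : Set α) := by
      rw [Finset.coe_insert, isAntichain_insert]
      simp only [Finset.coe_image, Finset.coe_range]
      refine ⟨?_, ?_⟩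
      · rintro _ ⟨i, hi, rfl⟩ _ ⟨j, hj, rfl⟩ hne hle
        obtain ⟨A, hA, hAanti, hcard, hxj⟩ := hxA j hj
        obtain ⟨z, hz, hcz⟩ := hsurj A hA hAanti hcard i hi
        have hzx := hAanti.eq hz hxj ((hxtop i hi A hA hAanti hcard z hz hcz).trans hle)
        apply hne
        rw [← hcz, hzx, hxc j hj]
      · rintro _ ⟨i, hi, rfl⟩ hne
        refine ⟨fun h => hne (le_antisymm h (hmax (hsub (hxS' i hi)) h)), hcase i hi⟩
    have hcard := hn _ (Finset.insert_subset haS fun z hz => by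
      obtain ⟨i, hi, rfl⟩ := Finset.mem_image.1 hz
      exact hsub (hxS' i (Finset.mem_range.1 hi))) hanti
    rw [Finset.card_insert_of_notMem, Finset.card_image_of_injOn hxinj, Finset.card_range] at hcard
    · have hlt : ∀ u ∈ S, u ≠ a → c u < k := fun u hu hua => hck u (Finset.mem_erase.2 ⟨hua, hu⟩)
      refine ⟨fun z => if z = a then k else c z, fun u hu => ?_, fun u hu v hv huv => ?_⟩
      · have := hlt u hu
        dsimp only
        split_ifs with hua
        · omega
        · have := this hua
          omega
      · by_cases hua : u = a <;> by_cases hva : v = a <;>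
          simp only [hua, hva, if_true, if_false] at huv
        · exact Or.inl (hua.trans hva.symm).le
        · exact absurd huv (hlt v hv hva).ne'
        · exact absurd huv (hlt u hu hua).ne
        · exact hc u (Finset.mem_erase.2 ⟨hua, hu⟩) v (Finset.mem_erase.2 ⟨hva, hv⟩) huv
    · intro ha
      obtain ⟨i, hi, hia⟩ := Finset.mem_image.1 ha
      exact Finset.ne_of_mem_erase (hxS' i (Finset.mem_range.1 hi)) hia

/-- A finite chain with at least `n` elements contains a strictly decreasing `n`-tuple. -/
theorem exists_strictAnti_of_chain {α : Type*} [PartialOrder α] (S : Finset α)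
    (hS : ∀ a ∈ S, ∀ b ∈ S, a ≤ b ∨ b ≤ a) {n : ℕ} (hn : n ≤ S.card) :
    ∃ f : Fin n → α, StrictAnti f ∧ ∀ i, f i ∈ S := by
  classical
  obtain ⟨T, hTS, hT⟩ := Finset.exists_subset_card_eq hn
  let _ : LinearOrder T :=
    { (inferInstance : PartialOrder T) with
      le_total := fun a b => hS a (hTS a.2) b (hTS b.2)
      toDecidableLE := Classical.decRel _ }
  let e := Fintype.orderIsoFinOfCardEq T ((Fintype.card_coe T).trans hT)
  refine ⟨fun i => (e i.rev : α), fun i j hij => ?_, fun i => hTS (e i.rev).2⟩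
  exact e.strictMono (Fin.rev_lt_rev.2 hij)

/-- Two incomparable halfspaces separating the same pair of vertices are transverse. -/
theorem Transv.of_mem_sepH {X : SimpleGraph V} {x y : V} {h k : Set V} (hh : h ∈ sepH X x y)
    (hk : k ∈ sepH X x y) (hhk : ¬ h ⊆ k) (hkh : ¬ k ⊆ h) : Transv h k := by
  obtain ⟨u, hu, hu'⟩ := Set.not_subset.1 hhk
  obtain ⟨v, hv, hv'⟩ := Set.not_subset.1 hkh
  exact ⟨⟨y, hh.2.1, hk.2.1⟩, ⟨v, hv', hv⟩, ⟨u, hu, hu'⟩, ⟨x, hh.2.2, hk.2.2⟩⟩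

/-- In dimension at most `D`, finitely many halfspaces separating `y` from `x` are covered by
`D` chains. -/
theorem exists_chain_coloring_of_dimLE {X : SimpleGraph V} {D : ℕ} (hdim : DimLE X D) {x y : V}
    (S : Finset (Set V)) (hS : ∀ h ∈ S, h ∈ sepH X x y) :
    ∃ c : Set V → ℕ, (∀ h ∈ S, c h < D) ∧
      ∀ h ∈ S, ∀ k ∈ S, c h = c k → h ⊆ k ∨ k ⊆ h := by
  refine exists_chain_coloring S D fun A hA hanti => hdim A (fun h hh => (hS h (hA hh)).1) ?_
  intro h hh k hk hne
  exact Transv.of_mem_sepH (hS h (hA hh)) (hS k (hA hk)) (hanti hh hk hne)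
    (hanti hk hh hne.symm)

theorem TightlyNested.eq_of_comparable_right {X : SimpleGraph V} {h k k' : Set V}
    (hk : TightlyNested X h k) (hk' : TightlyNested X h k') (hk_half : IsHalfspace X k)
    (hk'_half : IsHalfspace X k') (hcomp : k ⊆ k' ∨ k' ⊆ k) : k = k' := by
  by_contra hne
  obtain hsub | hsub := hcomp
  · exact hk.2 ⟨k', hk'_half, hk'.1, hsub.ssubset_of_ne hne⟩
  · exact hk'.2 ⟨k, hk_half, hk.1, hsub.ssubset_of_ne (Ne.symm hne)⟩

theorem TightlyNested.eq_of_comparable_left {X : SimpleGraph V} {h h' k : Set V}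
    (hh : TightlyNested X h k) (hh' : TightlyNested X h' k) (hh_half : IsHalfspace X h)
    (hh'_half : IsHalfspace X h') (hcomp : h ⊆ h' ∨ h' ⊆ h) : h = h' := by
  by_contra hne
  obtain hsub | hsub := hcomp
  · exact hh'.2 ⟨h, hh_half, hsub.ssubset_of_ne hne, hh.1⟩
  · exact hh.2 ⟨h', hh'_half, hsub.ssubset_of_ne (Ne.symm hne), hh'.1⟩

/-- Tightly nested pairs of halfspaces around a vertex `m`, whose upper and lower members each
form a chain, make up a staircase; so there are at most `σ` of them. -/
theorem card_tightlyNested_le {X : SimpleGraph V} {σ : ℕ} (hstair : StaircaseLE X σ) {x y m : V}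
    (P : Finset (Set V × Set V)) (hsep : ∀ p ∈ P, p.1 ∈ sepH X x y ∧ p.2 ∈ sepH X x y)
    (htight : ∀ p ∈ P, TightlyNested X p.1 p.2) (hm : ∀ p ∈ P, m ∈ p.1 ∧ m ∉ p.2)
    (hfst : ∀ p ∈ P, ∀ q ∈ P, p.1 ⊆ q.1 ∨ q.1 ⊆ p.1)
    (hsnd : ∀ p ∈ P, ∀ q ∈ P, p.2 ⊆ q.2 ∨ q.2 ⊆ p.2) : P.card ≤ σ := by
  classical
  by_contra! hlt
  have hinj : Set.InjOn Prod.fst (P : Set (Set V × Set V)) := by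
    intro p hp q hq hpq
    refine Prod.ext hpq ((htight p hp).eq_of_comparable_right ?_ (hsep p hp).2.1
      (hsep q hq).2.1 (hsnd p hp q hq))
    rw [show p.1 = q.1 from hpq]
    exact htight q hq
  obtain ⟨h, hanti, hmem⟩ := exists_strictAnti_of_chain (P.image Prod.fst) (n := σ + 1)
    (by
      simp only [Finset.mem_image]
      rintro _ ⟨p, hp, rfl⟩ _ ⟨q, hq, rfl⟩
      exact hfst p hp q hq)
    (by rwa [Finset.card_image_of_injOn hinj])
  choose p hp hph using fun i => Finset.mem_image.1 (hmem i)
  have hstep : ∀ i j, i < j → ¬ (p i).2 ⊆ (p j).1 := by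
    intro i j hij hsub
    refine (htight _ (hp i)).2 ⟨(p j).1, (hsep _ (hp j)).1.1, ?_, hsub.ssubset_of_ne ?_⟩
    · rw [hph, hph]
      exact hanti hij
    · exact fun heq => (hm _ (hp i)).2 (heq ▸ (hm _ (hp j)).1)
  refine hstair (fun i => (p i).1) (fun i => (p i).2) ⟨fun i => (hsep _ (hp i)).1.1,
    fun i => (hsep _ (hp i)).2.1, fun i j hij => ?_, fun i j hij => ?_,
    fun i => (htight _ (hp i)).1, fun i j hji => ?_⟩
  · simp only [hph]
    exact hanti hij
  · have hnot : ¬ (p i).2 ⊆ (p j).2 := fun hsub =>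
      hstep i j hij (hsub.trans (htight _ (hp j)).1.subset)
    exact ⟨(hsnd _ (hp i) _ (hp j)).resolve_left hnot, hnot⟩
  · exact Transv.of_mem_sepH (hsep _ (hp i)).1 (hsep _ (hp j)).2
      (fun hsub => (hm _ (hp j)).2 (hsub (hm _ (hp i)).1)) (hstep j i hji)

/-- Two H-segments that are comparable at every index and agree at one index are equal. -/
theorem IsHSegment.eq_of_comparable {X : SimpleGraph V} {n : ℕ} {t t' : Fin (n + 1) → Set V}
    (ht : IsHSegment X (n + 1) t) (ht' : IsHSegment X (n + 1) t')
    (hcomp : ∀ i, t i ⊆ t' i ∨ t' i ⊆ t i) {i : Fin (n + 1)} (hi : t i = t' i) : t = t' := by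
  have hstep : ∀ j : Fin n, t j.castSucc = t' j.castSucc ↔ t j.succ = t' j.succ := by
    intro j
    have h1 := ht.2 j.castSucc j.succ (by simp)
    have h2 := ht'.2 j.castSucc j.succ (by simp)
    constructor
    · intro heq
      exact h1.eq_of_comparable_right (heq ▸ h2) (ht.1 _) (ht'.1 _) (hcomp _)
    · intro heq
      exact h1.eq_of_comparable_left (heq ▸ h2) (ht.1 _) (ht'.1 _) (hcomp _)
  have hzero : ∀ j, t j = t' j ↔ t 0 = t' 0 := by
    intro j
    induction j using Fin.induction with
    | zero => rfl
    | succ j ih => exact (hstep j).symm.trans ih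
  exact funext fun j => (hzero j).2 ((hzero i).1 hi)

/-- The bound on the number of H-segments around `m`, for an arbitrary finite family. -/
theorem card_hSegment_le {X : SimpleGraph V} {D σ : ℕ} (hdim : DimLE X D)
    (hstair : StaircaseLE X σ) {x y m : V} {n : ℕ} (T : Finset (Fin (n + 1) → Set V))
    (hT : ∀ t ∈ T, IsHSegment X (n + 1) t ∧ SegIn X x y t ∧ m ∈ t 0 ∧ m ∉ t (Fin.last n)) :
    T.card ≤ n * σ * D ^ (n + 1) := by
  classical
  have hcross : ∀ t ∈ T, ∃ i : Fin n, m ∈ t i.castSucc ∧ m ∉ t i.succ := by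
    intro t ht
    by_contra! hno
    have hall : ∀ j, m ∈ t j := by
      intro j
      induction j using Fin.induction with
      | zero => exact (hT t ht).2.2.1
      | succ j ih => exact hno j ih
    exact (hT t ht).2.2.2 (hall _)
  obtain ⟨c, hcD, hc⟩ := exists_chain_coloring_of_dimLE hdim (x := x) (y := y)
    (T.biUnion fun t => Finset.univ.image t) (by
      simp only [Finset.mem_biUnion, Finset.mem_image, Finset.mem_univ, true_and]
      rintro _ ⟨t, ht, j, rfl⟩
      exact (hT t ht).2.1 j)
  have hmem : ∀ t ∈ T, ∀ j, t j ∈ T.biUnion fun t => Finset.univ.image t := fun t ht j =>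
    Finset.mem_biUnion.2 ⟨t, ht, Finset.mem_image_of_mem _ (Finset.mem_univ j)⟩
  have hcomp : ∀ t ∈ T, ∀ t' ∈ T, (fun j => c (t j)) = (fun j => c (t' j)) →
      ∀ j, t j ⊆ t' j ∨ t' j ⊆ t j := fun t ht t' ht' htt' j =>
    hc _ (hmem t ht j) _ (hmem t' ht' j) (congrFun htt' j)
  have hcover : T ⊆ (Finset.univ : Finset (Fin n)).biUnion fun i =>
      T.filter fun t => m ∈ t i.castSucc ∧ m ∉ t i.succ := by
    intro t ht
    obtain ⟨i, hi⟩ := hcross t ht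
    exact Finset.mem_biUnion.2 ⟨i, Finset.mem_univ i, Finset.mem_filter.2 ⟨ht, hi⟩⟩
  have hfix : ∀ i : Fin n,
      (T.filter fun t => m ∈ t i.castSucc ∧ m ∉ t i.succ).card ≤ σ * D ^ (n + 1) := by
    intro i
    have hcard := Finset.card_le_mul_card_image_of_maps_to
      (s := T.filter fun t => m ∈ t i.castSucc ∧ m ∉ t i.succ)
      (t := Fintype.piFinset fun _ : Fin (n + 1) => Finset.range D)
      (f := fun t j => c (t j)) (fun t ht => Fintype.mem_piFinset.2 fun j =>
        Finset.mem_range.2 (hcD _ (hmem t (Finset.mem_of_mem_filter t ht) j))) σ ?_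
    · simpa using hcard
    · intro colors _
      set F := (T.filter fun t => m ∈ t i.castSucc ∧ m ∉ t i.succ).filter
        fun t => (fun j => c (t j)) = colors with hF
      have hFmem : ∀ t ∈ F, t ∈ T ∧ (m ∈ t i.castSucc ∧ m ∉ t i.succ) ∧
          (fun j => c (t j)) = colors := by
        intro t ht
        simpa only [hF, Finset.mem_filter, and_assoc] using ht
      have hFcomp : ∀ t ∈ F, ∀ t' ∈ F, ∀ j, t j ⊆ t' j ∨ t' j ⊆ t j := fun t ht t' ht' =>
        hcomp t (hFmem t ht).1 t' (hFmem t' ht').1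
          ((hFmem t ht).2.2.trans (hFmem t' ht').2.2.symm)
      have hinj : Set.InjOn (fun t : Fin (n + 1) → Set V => (t i.castSucc, t i.succ))
          (F : Set (Fin (n + 1) → Set V)) := fun t ht t' ht' heq =>
        (hT t (hFmem t ht).1).1.eq_of_comparable (hT t' (hFmem t' ht').1).1
          (hFcomp t ht t' ht') (Prod.ext_iff.1 heq).1
      rw [← Finset.card_image_of_injOn hinj]
      apply card_tightlyNested_le hstair (x := x) (y := y) (m := m) <;>
        simp only [Finset.forall_mem_image]
      · exact fun t ht => ⟨(hT t (hFmem t ht).1).2.1 _, (hT t (hFmem t ht).1).2.1 _⟩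
      · exact fun t ht => (hT t (hFmem t ht).1).1.2 _ _ (by simp)
      · exact fun t ht => (hFmem t ht).2.1
      · exact fun t ht t' ht' => hFcomp t ht t' ht' _
      · exact fun t ht t' ht' => hFcomp t ht t' ht' _
  calc T.card ≤ _ := Finset.card_le_card hcover
    _ ≤ (Finset.univ : Finset (Fin n)).card * (σ * D ^ (n + 1)) :=
      Finset.card_biUnion_le_card_mul _ _ _ fun i _ => hfix i
    _ = n * σ * D ^ (n + 1) := by rw [Finset.card_fin, mul_assoc]

/-- A set all of whose finite subsets have at most `n` elements is finite with at most `n`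
elements. -/
theorem finite_and_ncard_le_of_forall_finset {α : Type*} {S : Set α} {n : ℕ}
    (h : ∀ T : Finset α, (T : Set α) ⊆ S → T.card ≤ n) : S.Finite ∧ S.ncard ≤ n := by
  have hfin : S.Finite := by
    by_contra hinf
    obtain ⟨T, hTS, hT⟩ := Set.Infinite.exists_subset_card_eq hinf (n + 1)
    have := h T hTS
    omega
  refine ⟨hfin, ?_⟩
  rw [Set.ncard_eq_toFinset_card S hfin]
  exact h _ (by simp)

/-- Lemma `lem:fd:segments:fix`: in a median graph of dimension at
most `D` and staircase length at most `σ`, for all vertices `x, y`, every `m ∈ [x,y]`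
and every `l ≥ 1`, the number of H-segments of length `l` contained in `[x,y]_H` with
`m` in their interior is at most `(l−1)·σ·D^l`. -/
theorem statement1 {V : Type*} (X : SimpleGraph V) (D σ : ℕ)
    (hmed : IsMedianGraph X) (hdim : DimLE X D) (hstair : StaircaseLE X σ)
    (x y m : V) (hm : m ∈ interval X x y) (l : ℕ) (hl : 1 ≤ l) :
    {t : Fin l → Set V | IsHSegment X l t ∧ SegIn X x y t ∧
        m ∈ t ⟨0, hl⟩ ∧ m ∉ t ⟨l - 1, by omega⟩}.Finite ∧
    {t : Fin l → Set V | IsHSegment X l t ∧ SegIn X x y t ∧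
        m ∈ t ⟨0, hl⟩ ∧ m ∉ t ⟨l - 1, by omega⟩}.ncard ≤ (l - 1) * σ * D ^ l := by
  obtain ⟨n, rfl⟩ : ∃ n, l = n + 1 := ⟨l - 1, by omega⟩
  exact finite_and_ncard_le_of_forall_finset fun T hT => card_hSegment_le hdim hstair T hT

end MedianQM
end

section
/- Let X be a median graph of dimension at most D and staircase length at most σ (D, σ natural numbers), let a group Γ act on X by graph automorphisms, let s be an H-segment of length l ≥ 1 in X, and let n ≥ 1. Let κ : V^{n+1} → ℝ be bounded, Γ-invariant, satisfy δκ = 0, and be non-transverse to the orbit Γs. Then there exists a bounded Γ-invariant function β : V^{n+2} → ℝ such that δβ = (δ¹f_s) ∪ κ as functions V^{n+3} → ℝ; that is, the cup product [δ¹f_s] ∪ [κ] is trivial in degree-(n+2) Γ-equivariant bounded cohomology of X. -/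
open scoped BigOperators

namespace MedianQM

variable {V : Type*}

theorem dist_symm (X : SimpleGraph V) (a b : V) : X.dist a b = X.dist b a :=
  SimpleGraph.dist_comm

theorem IsMedianGraph.dist_of_adj {X : SimpleGraph V} (hmed : IsMedianGraph X) {a b : V}
    (hab : X.Adj a b) (v : V) :
    X.dist v b = X.dist v a + 1 ∨ X.dist v a = X.dist v b + 1 := by
  obtain ⟨m, ⟨h₁, h₂, h₃⟩, -⟩ := hmed.2 v a b
  have h1 : X.dist a b = 1 := SimpleGraph.dist_eq_one_iff_adj.2 hab
  simp only [interval, Set.mem_ofPred_eq, h1] at h₁ h₂ h₃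
  rcases Nat.eq_zero_or_pos (X.dist a m) with h | h
  · obtain rfl := (hmed.1.dist_eq_zero_iff).1 h
    left; omega
  · have : X.dist m b = 0 := by omega
    obtain rfl := (hmed.1.dist_eq_zero_iff).1 this
    rw [dist_symm X m a, h1] at h₁
    right; omega

theorem IsMedianGraph.exists_adj_dist {X : SimpleGraph V} (hmed : IsMedianGraph X) {x y : V}
    (hxy : x ≠ y) : ∃ x', X.Adj x x' ∧ X.dist x y = X.dist x' y + 1 := by
  obtain ⟨p, hp⟩ := hmed.1.exists_walk_length_eq_dist x y
  cases p with
  | nil => exact absurd rfl hxy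
  | cons h q =>
    refine ⟨_, h, ?_⟩
    have h1 := SimpleGraph.dist_le q
    have h2 := hmed.dist_of_adj h y
    rw [SimpleGraph.Walk.length_cons] at hp
    rw [dist_symm X y, dist_symm X y] at h2
    omega

/-- In a median graph, opposite edges of a square define the same halfspaces. -/
theorem IsMedianGraph.dist_lt_of_square {X : SimpleGraph V} (hmed : IsMedianGraph X)
    {u v u' v' : V} (huv : X.Adj u v) (huv' : X.Adj u' v') (hu : X.Adj u u') (hv : X.Adj v v')
    (h₁ : u ≠ v') (h₂ : u' ≠ v) {w : V} (hw : X.dist w u < X.dist w v) :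
    X.dist w u' < X.dist w v' := by
  by_contra hcon
  have e₁ := hmed.dist_of_adj huv w
  have e₂ := hmed.dist_of_adj huv' w
  have e₃ := hmed.dist_of_adj hu w
  have e₄ := hmed.dist_of_adj hv w
  have e₅ := hmed.dist_of_adj huv u'
  have o₁ : X.dist u v = 1 := SimpleGraph.dist_eq_one_iff_adj.2 huv
  have o₂ : X.dist u' v' = 1 := SimpleGraph.dist_eq_one_iff_adj.2 huv'
  have o₃ : X.dist u u' = 1 := SimpleGraph.dist_eq_one_iff_adj.2 hu
  have o₄ : X.dist v v' = 1 := SimpleGraph.dist_eq_one_iff_adj.2 hv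
  have o₅ : X.dist u' v ≠ 0 := fun h => h₂ ((hmed.1.dist_eq_zero_iff).1 h)
  have c₁ := dist_symm X u u'
  have c₂ := dist_symm X u v
  have c₃ := dist_symm X v v'
  have c₄ := dist_symm X w u
  have c₅ := dist_symm X w u'
  have c₆ := dist_symm X w v
  have c₇ := dist_symm X w v'
  refine h₁ ((hmed.2 u' v w).unique ?_ ?_) <;>
    simp only [interval, Set.mem_ofPred_eq] <;> omega

theorem IsMedianGraph.dist_lt_iff_of_square {X : SimpleGraph V} (hmed : IsMedianGraph X)
    {u v u' v' : V} (huv : X.Adj u v) (huv' : X.Adj u' v') (hu : X.Adj u u') (hv : X.Adj v v')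
    (h₁ : u ≠ v') (h₂ : u' ≠ v) (w : V) :
    X.dist w u < X.dist w v ↔ X.dist w u' < X.dist w v' :=
  ⟨hmed.dist_lt_of_square huv huv' hu hv h₁ h₂,
    hmed.dist_lt_of_square huv' huv hu.symm hv.symm h₂ h₁⟩

/-- In a median graph, an edge crossing a hyperplane determines it. -/
theorem IsMedianGraph.dist_lt_iff_of_crossing {X : SimpleGraph V} (hmed : IsMedianGraph X)
    {a b u v : V} (hab : X.Adj a b) (huv : X.Adj u v)
    (hu : X.dist u a < X.dist u b) (hv : X.dist v b < X.dist v a) (w : V) :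
    X.dist w a < X.dist w b ↔ X.dist w u < X.dist w v := by
  induction hk : X.dist u a generalizing u v with
  | zero =>
    obtain rfl := (hmed.1.dist_eq_zero_iff).1 hk
    have e₁ := hmed.dist_of_adj huv b
    have e₂ := hmed.dist_of_adj hab v
    have o₁ : X.dist u v = 1 := SimpleGraph.dist_eq_one_iff_adj.2 huv
    have : X.dist v b = 0 := by rw [dist_symm X v u] at hv; omega
    obtain rfl := (hmed.1.dist_eq_zero_iff).1 this
    rfl
  | succ k ih =>
    have hne : u ≠ a := by rintro rfl; simp at hk
    obtain ⟨u', huu', hd⟩ := hmed.exists_adj_dist hne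
    have f₁ := hmed.dist_of_adj hab u
    have f₂ := hmed.dist_of_adj hab v
    have f₃ := hmed.dist_of_adj hab u'
    have f₄ := hmed.dist_of_adj huv a
    have f₅ := hmed.dist_of_adj huv b
    have f₆ := hmed.dist_of_adj huu' b
    have f₇ := hmed.dist_of_adj huv u'
    have o₁ : X.dist u v = 1 := SimpleGraph.dist_eq_one_iff_adj.2 huv
    have o₂ : X.dist u u' = 1 := SimpleGraph.dist_eq_one_iff_adj.2 huu'
    simp only [dist_symm X a, dist_symm X b] at f₄ f₅ f₆
    rw [dist_symm X u' u] at f₇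
    obtain ⟨v', ⟨g₁, g₂, g₃⟩, -⟩ := hmed.2 u' v b
    simp only [interval, Set.mem_ofPred_eq] at g₁ g₂ g₃
    have h0 : X.dist u' v ≠ 0 := fun h => by
      obtain rfl := (hmed.1.dist_eq_zero_iff).1 h
      omega
    rw [dist_symm X v' v] at g₁
    have a₁ : X.Adj u' v' := SimpleGraph.dist_eq_one_iff_adj.1 (by omega)
    have a₂ : X.Adj v v' := SimpleGraph.dist_eq_one_iff_adj.1 (by omega)
    have f₈ := hmed.dist_of_adj hab v'
    have f₉ := hmed.dist_of_adj a₂ a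
    simp only [dist_symm X a] at f₉
    rw [ih a₁ (by omega) (by omega) (by omega)]
    refine (hmed.dist_lt_iff_of_square huv a₁ huu' a₂ ?_ ?_ w).symm
    · rintro rfl; omega
    · rintro rfl; omega

theorem IsHalfspace.eq_of_crossing {X : SimpleGraph V} (hmed : IsMedianGraph X) {h : Set V}
    (hh : IsHalfspace X h) {u v : V} (huv : X.Adj u v) (hu : u ∈ h) (hv : v ∉ h) :
    h = {w | X.dist w u < X.dist w v} := by
  obtain ⟨a, b, hab, rfl⟩ := hh
  have := hmed.dist_of_adj hab v
  simp only [Set.mem_ofPred_eq] at hu hv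
  ext w
  exact hmed.dist_lt_iff_of_crossing hab huv hu (by omega) w

theorem IsHalfspace.convex {X : SimpleGraph V} (hmed : IsMedianGraph X) {h : Set V}
    (hh : IsHalfspace X h) {x m y : V} (hm : m ∈ interval X x y) (hx : x ∈ h) (hmh : m ∉ h) :
    y ∉ h := by
  induction hk : X.dist x m generalizing x with
  | zero =>
    obtain rfl := (hmed.1.dist_eq_zero_iff).1 hk
    exact absurd hx hmh
  | succ k ih =>
    have hne : x ≠ m := fun e => hmh (e ▸ hx)
    obtain ⟨x', hadj, hd⟩ := hmed.exists_adj_dist hne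
    have t₁ := hmed.1.dist_triangle (u := x') (v := m) (w := y)
    have t₂ := hmed.dist_of_adj hadj y
    simp only [dist_symm X y] at t₂
    simp only [interval, Set.mem_ofPred_eq] at hm
    by_cases hx' : x' ∈ h
    · exact ih (by simp only [interval, Set.mem_ofPred_eq]; omega) hx' (by omega)
    · rw [hh.eq_of_crossing hmed hadj hx hx']
      simp only [Set.mem_ofPred_eq, dist_symm X y]
      omega

theorem IsHalfspace.convex_compl {X : SimpleGraph V} (hmed : IsMedianGraph X) {h : Set V}
    (hh : IsHalfspace X h) {x m y : V} (hm : m ∈ interval X x y) (hx : x ∉ h) (hmh : m ∈ h) :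
    y ∈ h := by
  have hc : IsHalfspace X hᶜ := by
    obtain ⟨a, b, hab, rfl⟩ := hh
    refine ⟨b, a, hab.symm, ?_⟩
    ext v
    have := hmed.dist_of_adj hab v
    simp only [Set.mem_compl_iff, Set.mem_ofPred_eq]
    omega
  simpa using hc.convex hmed hm hx (by simpa using hmh)

theorem IsMedianGraph.finite_sepH {X : SimpleGraph V} (hmed : IsMedianGraph X) (x y : V) :
    (sepH X x y).Finite := by
  induction hk : X.dist x y generalizing x with
  | zero =>
    obtain rfl := (hmed.1.dist_eq_zero_iff).1 hk
    exact Set.finite_empty.subset fun h hh => hh.2.2 hh.2.1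
  | succ k ih =>
    have hne : x ≠ y := by rintro rfl; simp at hk
    obtain ⟨x', hadj, hd⟩ := hmed.exists_adj_dist hne
    refine ((ih x' (by omega)).union
      (Set.finite_singleton {w | X.dist w x' < X.dist w x})).subset fun h hh => ?_
    by_cases hmem : x' ∈ h
    · exact Or.inr (hh.1.eq_of_crossing hmed hadj.symm hmem hh.2.2)
    · exact Or.inl ⟨hh.1, hh.2.1, hmem⟩

/-- A finite poset whose antichains have at most `D` elements and which has more than `D * L`
elements contains a chain of length `L + 1`. -/
theorem exists_strictAnti_of_antichain_card_le {α : Type*} [PartialOrder α] {D : ℕ} (L : ℕ)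
    (S : Finset α) (hanti : ∀ A ⊆ S, IsAntichain (· ≤ ·) (A : Set α) → A.card ≤ D)
    (hS : D * L < S.card) :
    ∃ f : Fin (L + 1) → α, (∀ i, f i ∈ S) ∧ StrictAnti f := by
  classical
  induction L generalizing S with
  | zero =>
    obtain ⟨a, ha⟩ := Finset.card_pos.1 (by simpa using hS)
    exact ⟨fun _ => a, fun _ => ha, fun i j hij => by omega⟩
  | succ L ih =>
    set M := S.filter fun a => ∀ b ∈ S, ¬ a < b with hM
    have hMD : M.card ≤ D := by
      refine hanti M (Finset.filter_subset _ _) fun a ha b hb hab hle => ?_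
      simp only [hM, Finset.coe_filter, Set.mem_ofPred_eq] at ha hb
      exact ha.2 b hb.1 (lt_of_le_of_ne hle hab)
    have hcard : (S \ M).card + M.card = S.card :=
      Finset.card_sdiff_add_card_eq_card (Finset.filter_subset _ _)
    obtain ⟨f, hf, hfa⟩ := ih (S \ M) (fun A hA => hanti A (hA.trans Finset.sdiff_subset))
      (by rw [Nat.mul_succ] at hS; omega)
    have h0 := hf 0
    simp only [hM, Finset.mem_sdiff, Finset.mem_filter, not_and, not_forall, not_not] at h0
    obtain ⟨b, hb, hlt⟩ := h0.2 h0.1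
    refine ⟨Fin.cons b f, fun i => ?_, ?_⟩
    · refine Fin.cases ?_ (fun i => ?_) i
      · simpa using hb
      · simpa using (Finset.mem_sdiff.1 (hf i)).1
    · refine Fin.strictAnti_iff_succ_lt.2 fun i => ?_
      refine Fin.cases ?_ (fun i => ?_) i
      · simpa using hlt
      · rw [Fin.castSucc_succ, Fin.cons_succ, Fin.cons_succ]
        exact hfa i.castSucc_lt_succ

theorem transv_of_not_subset {X : SimpleGraph V} {x y : V} {h k : Set V}
    (hh : h ∈ sepH X x y) (hk : k ∈ sepH X x y) (h₁ : ¬ h ⊆ k) (h₂ : ¬ k ⊆ h) :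
    Transv h k := by
  obtain ⟨a, ha, ha'⟩ := Set.not_subset.1 h₁
  obtain ⟨b, hb, hb'⟩ := Set.not_subset.1 h₂
  exact ⟨⟨y, hh.2.1, hk.2.1⟩, ⟨b, hb', hb⟩, ⟨a, ha, ha'⟩, ⟨x, hh.2.2, hk.2.2⟩⟩

theorem card_le_of_antichain {X : SimpleGraph V} {D : ℕ} (hdim : DimLE X D) {x y : V}
    {A : Finset (Set V)} (hA : ∀ h ∈ A, h ∈ sepH X x y)
    (hanti : IsAntichain (· ≤ ·) (A : Set (Set V))) : A.card ≤ D :=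
  hdim A (fun h hh => (hA h hh).1) fun h hh k hk hne =>
    transv_of_not_subset (hA h hh) (hA k hk) (hanti hh hk hne) (hanti hk hh hne.symm)

theorem card_tight_below_le {X : SimpleGraph V} {D : ℕ} (hdim : DimLE X D) {x y : V}
    {A : Finset (Set V)} {h : Set V} (hA : ∀ k ∈ A, k ∈ sepH X x y ∧ TightlyNested X h k) :
    A.card ≤ D :=
  card_le_of_antichain hdim (fun k hk => (hA k hk).1) fun k hk k' hk' hne hle =>
    (hA k hk).2.2 ⟨k', (hA k' hk').1.1, (hA k' hk').2.1, lt_of_le_of_ne hle hne⟩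

theorem card_tight_above_le {X : SimpleGraph V} {D : ℕ} (hdim : DimLE X D) {x y : V}
    {A : Finset (Set V)} {k : Set V} (hA : ∀ h ∈ A, h ∈ sepH X x y ∧ TightlyNested X h k) :
    A.card ≤ D :=
  card_le_of_antichain hdim (fun h hh => (hA h hh).1) fun h hh h' hh' hne hle =>
    (hA h' hh').2.2 ⟨h, (hA h hh).1.1, lt_of_le_of_ne hle hne, (hA h hh).2.1⟩

/-- The halfspaces in `[x,y]_H` containing `m` that are tightly nested over a halfspace in
`[x,y]_H` not containing `m` are bounded in number. -/
theorem card_tight_across_le {X : SimpleGraph V} {D σ : ℕ} (hdim : DimLE X D)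
    (hstair : StaircaseLE X σ) {x y m : V} {P : Finset (Set V)}
    (hP : ∀ h ∈ P, h ∈ sepH X x y ∧ m ∈ h ∧
      ∃ k ∈ sepH X x y, m ∉ k ∧ TightlyNested X h k) :
    P.card ≤ D * (D * σ) := by
  classical
  by_contra! hlt
  obtain ⟨h, hmem, hanti⟩ := exists_strictAnti_of_antichain_card_le (D * σ) P
    (fun A hA => card_le_of_antichain hdim fun k hk => (hP k (hA hk)).1) hlt
  choose hsep hm k ksep hmk htight using fun i => hP (h i) (hmem i)
  have hnle : ∀ i j, i < j → ¬ k i ⊆ k j := fun i j hij hle =>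
    (htight i).2 ⟨h j, (hsep j).1, hanti hij, lt_of_le_of_lt hle (htight j).1⟩
  have hinj : Function.Injective k := by
    intro i j hij
    rcases lt_trichotomy i j with hlt | rfl | hlt
    · exact absurd hij.le (hnle i j hlt)
    · rfl
    · exact absurd hij.ge (hnle j i hlt)
  obtain ⟨g, gmem, ganti⟩ := exists_strictAnti_of_antichain_card_le σ (Finset.univ.image k)
    (fun A hA => card_le_of_antichain hdim fun a ha => by
      obtain ⟨i, -, rfl⟩ := Finset.mem_image.1 (hA ha)
      exact ksep i)
    (by rw [Finset.card_image_of_injective _ hinj]; simp)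
  choose φ _ hφ using fun i => Finset.mem_image.1 (gmem i)
  have hmono : ∀ i j, i < j → φ i < φ j := by
    intro i j hij
    have hlt : k (φ j) < k (φ i) := by rw [hφ, hφ]; exact ganti hij
    by_contra hcon
    rcases (not_lt.1 hcon).eq_or_lt with he | hl
    · exact hlt.ne (congrArg k he)
    · exact hnle _ _ hl hlt.le
  refine hstair (h ∘ φ) (k ∘ φ) ⟨fun i => (hsep _).1, fun i => (ksep _).1,
    fun i j hij => hanti (hmono i j hij), fun i j hij => ?_, fun i => (htight _).1,
    fun i j hji => ?_⟩
  · simp only [Function.comp_apply, hφ]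
    exact ganti hij
  · refine transv_of_not_subset (hsep _) (ksep _) (fun hle => hmk _ (hle (hm _)))
      fun hle => ?_
    have hlt : k (φ j) < h (φ i) := lt_of_le_of_ne hle fun he => hmk (φ j) (he ▸ hm (φ i))
    exact (htight (φ j)).2 ⟨h (φ i), (hsep _).1, hanti (hmono j i hji), hlt⟩

/-- The number of `H`-segments of length `l` in `[x,y]_H` having `m` in their interior is bounded
independently of `x`, `m`, `y`. -/
theorem exists_card_interior_le {X : SimpleGraph V} {D σ : ℕ} (hmed : IsMedianGraph X)
    (hdim : DimLE X D) (hstair : StaircaseLE X σ) (l : ℕ) :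
    ∃ C : ℕ, ∀ (x m y : V) (I : Finset (Fin l → Set V)),
      (∀ t ∈ I, IsHSegment X l t ∧ SegIn X x y t ∧ (∃ i, m ∈ t i) ∧ ∃ i, m ∉ t i) →
        I.card ≤ C := by
  classical
  refine ⟨(D * (D * σ) * (1 + (D + D)) ^ l) ^ l, fun x m y I hI => ?_⟩
  set H := (hmed.finite_sepH x y).toFinset with hH
  have memH : ∀ h, h ∈ H ↔ h ∈ sepH X x y := fun h => by simp [hH]
  set P := H.filter fun h => m ∈ h ∧ ∃ k ∈ sepH X x y, m ∉ k ∧ TightlyNested X h k with hPdef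
  have hP : P.card ≤ D * (D * σ) := card_tight_across_le hdim hstair (x := x) (y := y) (m := m)
    fun h hh => by
      rw [hPdef, Finset.mem_filter, memH] at hh
      exact hh
  let N : Set V → Finset (Set V) := fun h =>
    (H.filter fun k => TightlyNested X h k) ∪ H.filter fun k => TightlyNested X k h
  have hN : ∀ h, (N h).card ≤ D + D := fun h =>
    (Finset.card_union_le _ _).trans <| add_le_add
      (card_tight_below_le hdim (x := x) (y := y) (h := h) fun k hk => by
        rwa [Finset.mem_filter, memH] at hk)
      (card_tight_above_le hdim (x := x) (y := y) (k := h) fun k hk => by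
        rwa [Finset.mem_filter, memH] at hk)
  let Q : ℕ → Finset (Set V) := fun j => Nat.rec P (fun _ q => q ∪ q.biUnion N) j
  have Qsucc : ∀ j, Q (j + 1) = Q j ∪ (Q j).biUnion N := fun j => rfl
  have hQ : ∀ j, (Q j).card ≤ D * (D * σ) * (1 + (D + D)) ^ j := by
    intro j
    induction j with
    | zero =>
      rw [pow_zero, mul_one]
      exact hP
    | succ j ih =>
      rw [Qsucc]
      calc _ ≤ (Q j).card + (Q j).card * (D + D) :=
            (Finset.card_union_le _ _).trans
              (Nat.add_le_add_left (Finset.card_biUnion_le_card_mul _ _ _ fun h _ => hN h) _)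
        _ = (Q j).card * (1 + (D + D)) := by ring
        _ ≤ (D * (D * σ) * (1 + (D + D)) ^ j) * (1 + (D + D)) := Nat.mul_le_mul_right _ ih
        _ = _ := by ring
  have Qmono : Monotone Q := monotone_nat_of_le_succ fun j => by
    rw [Qsucc]; exact Finset.subset_union_left
  have key : I ⊆ Fintype.piFinset fun _ : Fin l => Q l := by
    intro t ht
    obtain ⟨⟨hhalf, htight⟩, hin, ⟨i₁, hi₁⟩, i₂, hi₂⟩ := hI t ht
    have step : ∃ i : ℕ, ∃ hi : i + 1 < l, m ∈ t ⟨i, by omega⟩ ∧ m ∉ t ⟨i + 1, hi⟩ := by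
      by_contra! hcon
      have hconst : ∀ i (hi : i < l), m ∈ t ⟨i, hi⟩ ↔ m ∈ t ⟨0, by omega⟩ := by
        intro i
        induction i with
        | zero => intro hi; rfl
        | succ i ih =>
          intro hi
          rw [← ih (by omega)]
          exact ⟨fun h => (htight ⟨i, by omega⟩ ⟨i + 1, hi⟩ rfl).1.1 h, hcon i hi⟩
      exact hi₂ ((hconst i₂ i₂.2).2 ((hconst i₁ i₁.2).1 hi₁))
    obtain ⟨i, hi, hmi, hmi'⟩ := step
    have ht0 : t ⟨i, by omega⟩ ∈ P := by
      rw [hPdef, Finset.mem_filter, memH]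
      exact ⟨hin _, hmi, _, hin ⟨i + 1, hi⟩, hmi', htight _ _ rfl⟩
    have hup : ∀ j (hj : i + j < l), t ⟨i + j, hj⟩ ∈ Q j := by
      intro j
      induction j with
      | zero => intro _; exact ht0
      | succ j ih =>
        intro hj
        rw [Qsucc]
        refine Finset.mem_union_right _ (Finset.mem_biUnion.2 ⟨_, ih (by omega), ?_⟩)
        refine Finset.mem_union_left _ (Finset.mem_filter.2 ⟨(memH _).2 (hin _), ?_⟩)
        exact htight _ _ rfl
    have hdown : ∀ j (hj : j ≤ i), t ⟨i - j, by omega⟩ ∈ Q j := by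
      intro j
      induction j with
      | zero => intro _; exact ht0
      | succ j ih =>
        intro hj
        rw [Qsucc]
        refine Finset.mem_union_right _ (Finset.mem_biUnion.2 ⟨_, ih (by omega), ?_⟩)
        refine Finset.mem_union_right _ (Finset.mem_filter.2 ⟨(memH _).2 (hin _), ?_⟩)
        exact htight _ _ (by simp only; omega)
    rw [Fintype.mem_piFinset]
    intro j
    rcases le_total i j with hij | hij
    · have := hup (j - i) (by omega)
      simp only [Nat.add_sub_cancel' hij] at this
      exact Qmono (by omega) this
    · have := hdown (i - j) (by omega)
      simp only [Nat.sub_sub_self hij] at this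
      exact Qmono (by omega) this
  calc I.card ≤ _ := Finset.card_le_card key
    _ = (Q l).card ^ l := by simp
    _ ≤ _ := Nat.pow_le_pow_left (hQ l) l

section Action

variable {Γ : Type*} [Group Γ] [MulAction Γ V] {X : SimpleGraph V}

theorem ActsOn.dist_smul_le (hact : ActsOn Γ X) (hconn : X.Connected) (γ : Γ) (a b : V) :
    X.dist (γ • a) (γ • b) ≤ X.dist a b := by
  obtain ⟨p, hp⟩ := hconn.exists_walk_length_eq_dist a b
  let f : X →g X := ⟨fun v => γ • v, fun {a b} h => hact γ a b h⟩
  rw [← hp, ← p.length_map (f := f)]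
  exact SimpleGraph.dist_le (p.map f)

theorem ActsOn.dist_smul (hact : ActsOn Γ X) (hconn : X.Connected) (γ : Γ) (a b : V) :
    X.dist (γ • a) (γ • b) = X.dist a b := by
  refine le_antisymm (hact.dist_smul_le hconn γ a b) ?_
  simpa using hact.dist_smul_le hconn γ⁻¹ (γ • a) (γ • b)

theorem mem_segSMul {l : ℕ} (γ : Γ) (s : Fin l → Set V) (i : Fin l) (v : V) :
    v ∈ segSMul γ s i ↔ γ⁻¹ • v ∈ s i :=
  Set.mem_smul_set_iff_inv_smul_mem

theorem smul_mem_segSMul {l : ℕ} (γ : Γ) (s : Fin l → Set V) (i : Fin l) (v : V) :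
    γ • v ∈ segSMul γ s i ↔ v ∈ s i := by
  rw [mem_segSMul, inv_smul_smul]

theorem segSMul_segSMul {l : ℕ} (γ δ : Γ) (s : Fin l → Set V) :
    segSMul γ (segSMul δ s) = segSMul (γ * δ) s := by
  ext i v
  simp [mem_segSMul, mul_smul]

theorem segSMul_inv_segSMul {l : ℕ} (γ : Γ) (s : Fin l → Set V) :
    segSMul γ⁻¹ (segSMul γ s) = s := by
  ext i v
  simp [mem_segSMul]

theorem ActsOn.image_dist_lt (hact : ActsOn Γ X) (hconn : X.Connected) (γ : Γ) (a b : V) :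
    (γ • ·) '' {v | X.dist v a < X.dist v b} =
      {v | X.dist v (γ • a) < X.dist v (γ • b)} := by
  ext v
  refine Set.mem_smul_set_iff_inv_smul_mem.trans ?_
  rw [Set.mem_ofPred_eq, Set.mem_ofPred_eq, ← hact.dist_smul hconn γ (γ⁻¹ • v) a,
    ← hact.dist_smul hconn γ (γ⁻¹ • v) b, smul_inv_smul]

theorem IsHalfspace.image_smul (hact : ActsOn Γ X) (hconn : X.Connected) {h : Set V}
    (hh : IsHalfspace X h) (γ : Γ) : IsHalfspace X ((γ • ·) '' h) := by
  obtain ⟨a, b, hab, rfl⟩ := hh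
  exact ⟨γ • a, γ • b, hact γ a b hab, hact.image_dist_lt hconn γ a b⟩

theorem EdgeDual.image_smul (hact : ActsOn Γ X) (hconn : X.Connected) {h : Set V} {a b : V}
    (hh : EdgeDual X h a b) (γ : Γ) : EdgeDual X ((γ • ·) '' h) (γ • a) (γ • b) := by
  refine ⟨hact γ a b hh.1, hh.2.imp ?_ ?_⟩ <;>
  · rintro rfl
    exact hact.image_dist_lt hconn γ _ _

theorem TightlyNested.image_smul (hact : ActsOn Γ X) (hconn : X.Connected) {h k : Set V}
    (hk : TightlyNested X h k) (γ : Γ) :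
    TightlyNested X ((γ • ·) '' h) ((γ • ·) '' k) := by
  have hmono : ∀ (δ : Γ) {a b : Set V}, a ⊂ b → (δ • ·) '' a ⊂ (δ • ·) '' b := fun δ a b hab =>
    (MulAction.injective δ).image_strictMono hab
  have hinv : ∀ a : Set V, (γ⁻¹ • ·) '' ((γ • ·) '' a) = a := fun a => by
    simp [Set.image_image]
  refine ⟨hmono γ hk.1, ?_⟩
  rintro ⟨h', hh', h₁, h₂⟩
  refine hk.2 ⟨_, hh'.image_smul hact hconn γ⁻¹, ?_, ?_⟩
  · simpa only [hinv] using hmono γ⁻¹ h₁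
  · simpa only [hinv] using hmono γ⁻¹ h₂

theorem IsHSegment.segSMul (hact : ActsOn Γ X) (hconn : X.Connected) {l : ℕ}
    {s : Fin l → Set V} (hs : IsHSegment X l s) (γ : Γ) : IsHSegment X l (segSMul γ s) :=
  ⟨fun i => (hs.1 i).image_smul hact hconn γ,
    fun i j hij => (hs.2 i j hij).image_smul hact hconn γ⟩

theorem IsHead.smul (hact : ActsOn Γ X) (hconn : X.Connected) {l : ℕ} {hl : 0 < l}
    {s : Fin l → Set V} {a : V} (ha : IsHead X hl s a) (γ : Γ) :
    IsHead X hl (segSMul γ s) (γ • a) := by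
  obtain ⟨h₁, b, hb⟩ := ha
  exact ⟨by rwa [smul_mem_segSMul], γ • b, hb.image_smul hact hconn γ⟩

theorem IsHSegment.exists_isHead {l : ℕ} (hl : 0 < l) {s : Fin l → Set V}
    (hs : IsHSegment X l s) : ∃ a, IsHead X hl s a := by
  obtain ⟨a, b, hab, h⟩ := hs.1 ⟨0, hl⟩
  refine ⟨b, ?_, a, hab.symm, Or.inr h⟩
  simp [h]

theorem segSMul_mem_translatesIn (hact : ActsOn Γ X) (hconn : X.Connected) {l : ℕ}
    {s t : Fin l → Set V} {x y : V} (ht : t ∈ translatesIn X Γ s x y) (γ : Γ) :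
    segSMul γ t ∈ translatesIn X Γ s (γ • x) (γ • y) := by
  obtain ⟨⟨δ, rfl⟩, hin⟩ := ht
  refine ⟨⟨γ * δ, segSMul_segSMul γ δ s⟩, fun i => ⟨(hin i).1.image_smul hact hconn γ, ?_, ?_⟩⟩
  · exact (smul_mem_segSMul γ _ i y).2 (hin i).2.1
  · exact fun h => (hin i).2.2 ((smul_mem_segSMul γ _ i x).1 h)

theorem IsMedianGraph.finite_translatesIn (hmed : IsMedianGraph X) {l : ℕ}
    (s : Fin l → Set V) (x y : V) : (translatesIn X Γ s x y).Finite :=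
  (Set.Finite.pi' fun _ => hmed.finite_sepH x y).subset fun _ ht => ht.2

theorem sum_translatesIn_smul (hmed : IsMedianGraph X) (hact : ActsOn Γ X) {l : ℕ}
    {s : Fin l → Set V} (γ : Γ) (x y : V) {w w' : (Fin l → Set V) → ℝ}
    (hw : ∀ t ∈ translatesIn X Γ s x y, w (segSMul γ t) = w' t) :
    ∑ t ∈ (hmed.finite_translatesIn (Γ := Γ) s (γ • x) (γ • y)).toFinset, w t =
      ∑ t ∈ (hmed.finite_translatesIn (Γ := Γ) s x y).toFinset, w' t := by
  refine (Finset.sum_bij' (fun t _ => segSMul γ t) (fun t _ => segSMul γ⁻¹ t)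
    (fun t ht => ?_) (fun t ht => ?_) (fun t _ => segSMul_inv_segSMul γ t)
    (fun t _ => ?_) (fun t ht => ?_)).symm
  · rw [Set.Finite.mem_toFinset] at ht ⊢
    exact segSMul_mem_translatesIn hact hmed.1 ht γ
  · rw [Set.Finite.mem_toFinset] at ht ⊢
    simpa using segSMul_mem_translatesIn hact hmed.1 ht γ⁻¹
  · simpa using segSMul_inv_segSMul γ⁻¹ t
  · exact (hw t ((Set.Finite.mem_toFinset _).1 ht)).symm

/-- Segments separating `y` from `x` split at a point `m` between them, up to a bounded number. -/
theorem exists_translatesIn_split {D σ : ℕ} (hmed : IsMedianGraph X) (hdim : DimLE X D)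
    (hstair : StaircaseLE X σ) (hact : ActsOn Γ X) {l : ℕ} (hl : 0 < l) {s : Fin l → Set V}
    (hs : IsHSegment X l s) :
    ∃ C : ℕ, ∀ x m y : V, m ∈ interval X x y → ∃ I : Finset (Fin l → Set V), I.card ≤ C ∧
      ∀ w : (Fin l → Set V) → ℝ,
        ∑ t ∈ (hmed.finite_translatesIn (Γ := Γ) s x y).toFinset, w t =
          ∑ t ∈ (hmed.finite_translatesIn (Γ := Γ) s x m).toFinset, w t +
          ∑ t ∈ (hmed.finite_translatesIn (Γ := Γ) s m y).toFinset, w t + ∑ t ∈ I, w t := by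
  classical
  obtain ⟨C, hC⟩ := exists_card_interior_le hmed hdim hstair l
  refine ⟨C, fun x m y hm => ?_⟩
  set T := (hmed.finite_translatesIn (Γ := Γ) s x y).toFinset with hT
  have hmT : ∀ t, t ∈ T ↔ t ∈ translatesIn X Γ s x y := fun t => Set.Finite.mem_toFinset _
  have h₁ : (hmed.finite_translatesIn (Γ := Γ) s x m).toFinset =
      T.filter fun t => ∀ i, m ∈ t i := by
    ext t
    rw [Set.Finite.mem_toFinset, Finset.mem_filter, hmT]
    constructor
    · rintro ⟨hγ, hin⟩
      exact ⟨⟨hγ, fun i => ⟨(hin i).1, (hin i).1.convex_compl hmed hm (hin i).2.2 (hin i).2.1,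
        (hin i).2.2⟩⟩, fun i => (hin i).2.1⟩
    · rintro ⟨⟨hγ, hin⟩, hmi⟩
      exact ⟨hγ, fun i => ⟨(hin i).1, hmi i, (hin i).2.2⟩⟩
  have h₂ : (hmed.finite_translatesIn (Γ := Γ) s m y).toFinset =
      (T.filter fun t => ¬ ∀ i, m ∈ t i).filter fun t => ∀ i, m ∉ t i := by
    ext t
    rw [Set.Finite.mem_toFinset, Finset.mem_filter, Finset.mem_filter, hmT]
    constructor
    · rintro ⟨hγ, hin⟩
      exact ⟨⟨⟨hγ, fun i => ⟨(hin i).1, (hin i).2.1,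
        fun hx => (hin i).1.convex hmed hm hx (hin i).2.2 (hin i).2.1⟩⟩,
        fun hall => (hin ⟨0, hl⟩).2.2 (hall _)⟩, fun i => (hin i).2.2⟩
    · rintro ⟨⟨⟨hγ, hin⟩, -⟩, hmi⟩
      exact ⟨hγ, fun i => ⟨(hin i).1, (hin i).2.1, hmi i⟩⟩
  refine ⟨(T.filter fun t => ¬ ∀ i, m ∈ t i).filter fun t => ¬ ∀ i, m ∉ t i,
    hC x m y _ fun t ht => ?_, fun w => ?_⟩
  · rw [Finset.mem_filter, Finset.mem_filter, hmT] at ht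
    obtain ⟨⟨⟨⟨γ, rfl⟩, hin⟩, hn⟩, hp⟩ := ht
    push Not at hn hp
    exact ⟨hs.segSMul hact hmed.1 γ, hin, hp, hn⟩
  · rw [h₁, h₂, add_assoc, Finset.sum_filter_add_sum_filter_not,
      Finset.sum_filter_add_sum_filter_not]

end Action

section WeightedCount

variable {τ : Type*}

/-- The antisymmetric weighted count attached to a family of finite sets. -/
noncomputable def weightedCount (T : V → V → Finset τ) (w : τ → ℝ) (x y : V) : ℝ :=
  ∑ t ∈ T x y, w t - ∑ t ∈ T y x, w t

theorem weightedCount_const (T : V → V → Finset τ) (c : ℝ) (x y : V) :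
    weightedCount T (fun _ => c) x y = (((T x y).card : ℝ) - (T y x).card) * c := by
  simp [weightedCount, sub_mul]

theorem weightedCount_sub_sum {ι : Type*} [Fintype ι] (T : V → V → Finset τ) (u : τ → ℝ)
    (c : ι → ℝ) (v : ι → τ → ℝ) (x y : V) :
    weightedCount T (fun t => u t - ∑ k, c k * v k t) x y =
      weightedCount T u x y - ∑ k, c k * weightedCount T (v k) x y := by
  simp only [weightedCount, Finset.sum_sub_distrib, mul_sub, Finset.mul_sum]
  rw [Finset.sum_comm, Finset.sum_comm (s := T y x)]
  ring

theorem abs_d1_weightedCount_le {X : SimpleGraph V} (hmed : IsMedianGraph X)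
    (T : V → V → Finset τ) {C : ℕ}
    (hT : ∀ x m y : V, m ∈ interval X x y → ∃ I : Finset τ, I.card ≤ C ∧
      ∀ w : τ → ℝ, ∑ t ∈ T x y, w t = ∑ t ∈ T x m, w t + ∑ t ∈ T m y, w t + ∑ t ∈ I, w t)
    {w : τ → ℝ} {K : ℝ} (hK : 0 ≤ K) (hw : ∀ t, |w t| ≤ K) (x y z : V) :
    |d1 (weightedCount T w) x y z| ≤ 6 * (C * K) := by
  have hsplit : ∀ x m y : V, m ∈ interval X x y →
      |∑ t ∈ T x y, w t - ∑ t ∈ T x m, w t - ∑ t ∈ T m y, w t| ≤ C * K := by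
    intro x m y hm
    obtain ⟨I, hI, hsum⟩ := hT x m y hm
    have h0 : ∑ t ∈ T x y, w t - ∑ t ∈ T x m, w t - ∑ t ∈ T m y, w t = ∑ t ∈ I, w t := by
      rw [hsum w]; ring
    rw [h0]
    calc |∑ t ∈ I, w t| ≤ ∑ t ∈ I, |w t| := Finset.abs_sum_le_sum_abs _ _
      _ ≤ I.card • K := Finset.sum_le_card_nsmul _ _ _ fun t _ => hw t
      _ = I.card * K := nsmul_eq_mul _ _
      _ ≤ C * K := by gcongr
  have hsymm : ∀ {x m y : V}, m ∈ interval X x y → m ∈ interval X y x := by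
    intro x m y hm
    simp only [interval, Set.mem_ofPred_eq, dist_symm X y, dist_symm X m x] at hm ⊢
    omega
  obtain ⟨m, ⟨h₁, h₂, h₃⟩, -⟩ := hmed.2 x y z
  have a₁ := abs_le.1 (hsplit _ _ _ h₁)
  have a₂ := abs_le.1 (hsplit _ _ _ h₂)
  have a₃ := abs_le.1 (hsplit _ _ _ h₃)
  have b₁ := abs_le.1 (hsplit _ _ _ (hsymm h₁))
  have b₂ := abs_le.1 (hsplit _ _ _ (hsymm h₂))
  have b₃ := abs_le.1 (hsplit _ _ _ (hsymm h₃))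
  rw [abs_le]
  simp only [d1, weightedCount]
  constructor <;> linarith

end WeightedCount

section Cochain

variable {W : Type*}

theorem cob_cob {m : ℕ} (η : (Fin (m + 1) → W) → ℝ) : cob (cob η) = 0 := by
  funext x
  simp only [cob, Pi.zero_apply, Finset.mul_sum]
  rw [Finset.sum_sigma']
  refine Finset.sum_involution (fun p _ => ⟨p.1.succAbove p.2, p.2.predAbove p.1⟩) ?_ ?_ ?_ ?_
  · rintro ⟨j, i⟩ -
    have h := Fin.neg_one_pow_succAbove_add_predAbove (R := ℝ) j i
    simp only [Fin.succAbove_succAbove_succAbove_predAbove]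
    rw [← mul_assoc, ← mul_assoc, ← pow_add, ← pow_add, h]
    ring
  · rintro ⟨j, i⟩ - - h
    exact Fin.succAbove_ne j i (congrArg Sigma.fst h)
  · exact fun _ _ => by simp
  · rintro ⟨j, i⟩ -
    simp [Fin.succAbove_succAbove_predAbove, Fin.predAbove_predAbove_succAbove]

theorem IsInvariant.cob {Γ : Type*} [SMul Γ W] {m : ℕ} {η : (Fin (m + 1) → W) → ℝ}
    (hη : IsInvariant Γ η) : IsInvariant Γ (cob η) := by
  intro γ x
  simp only [MedianQM.cob]
  exact Finset.sum_congr rfl fun j _ => by rw [hη γ fun i => x (j.succAbove i)]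

theorem one_succAbove_succ {m : ℕ} (i : Fin (m + 1)) :
    (1 : Fin (m + 3)).succAbove i.succ = i.succ.succ := by
  rw [← Fin.succ_zero_eq_one, Fin.succ_succAbove_succ, Fin.succAbove_zero]

theorem one_succAbove_one {m : ℕ} : (1 : Fin (m + 3)).succAbove (1 : Fin (m + 2)) = 2 := by
  rw [← Fin.succ_zero_eq_one, ← Fin.succ_zero_eq_one, Fin.succ_succAbove_succ]; rfl

theorem one_succAbove_zero {m : ℕ} : (1 : Fin (m + 3)).succAbove (0 : Fin (m + 2)) = 0 := by
  rw [← Fin.succ_zero_eq_one, Fin.succ_succAbove_zero]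

theorem succ_succ_succAbove_one {m : ℕ} (k : Fin (m + 1)) :
    k.succ.succ.succAbove (1 : Fin (m + 2)) = 1 := by
  rw [← Fin.succ_zero_eq_one, Fin.succ_succAbove_succ, Fin.succ_succAbove_zero]; rfl

/-- The coboundary, separating the first face. -/
theorem cob_eq_sub_sum {m : ℕ} (β : (Fin (m + 1) → W) → ℝ) (x : Fin (m + 2) → W) :
    cob β x = β (fun i => x i.succ) -
      ∑ k : Fin (m + 1), (-1) ^ (k : ℕ) * β (fun i => x (k.succ.succAbove i)) := by
  simp only [cob]
  rw [Fin.sum_univ_succ, sub_eq_add_neg, ← Finset.sum_neg_distrib]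
  simp [pow_succ]

/-- The coboundary, separating the first two faces. -/
theorem cob_eq_sub_add_sum {m : ℕ} (β : (Fin (m + 2) → W) → ℝ) (x : Fin (m + 3) → W) :
    cob β x = β (fun i => x i.succ) - β (fun i => x ((1 : Fin (m + 3)).succAbove i)) +
      ∑ k : Fin (m + 1), (-1) ^ (k : ℕ) * β (fun i => x (k.succ.succ.succAbove i)) := by
  rw [cob_eq_sub_sum, Fin.sum_univ_succ, ← sub_sub, sub_eq_add_neg _ (∑ _, _),
    ← Finset.sum_neg_distrib]
  simp [pow_succ]

/-- Leibniz rule for the cup product of a `1`-cochain with a cocycle. -/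
theorem cob_cup {m : ℕ} (f : W → W → ℝ) {κ : (Fin (m + 1) → W) → ℝ} (hκ : cob κ = 0)
    (x : Fin (m + 3) → W) :
    cob (fun y : Fin (m + 2) → W => f (y 0) (y 1) * κ fun i => y i.succ) x =
      d1 f (x 0) (x 1) (x 2) * κ fun i => x i.succ.succ := by
  have h := congrFun hκ fun i => x i.succ
  rw [cob_eq_sub_sum, Pi.zero_apply, sub_eq_zero] at h
  rw [cob_eq_sub_add_sum, d1]
  have e : ∀ k : Fin (m + 1),
      (-1 : ℝ) ^ (k : ℕ) * (f (x (k.succ.succ.succAbove 0)) (x (k.succ.succ.succAbove 1)) *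
        κ fun i => x (k.succ.succ.succAbove i.succ)) =
      f (x 0) (x 1) * ((-1) ^ (k : ℕ) * κ fun i => x (k.succ.succAbove i).succ) := by
    intro k
    simp only [succ_succ_succAbove_one, Fin.succ_succAbove_zero, Fin.succ_succAbove_succ]
    ring
  simp only [e, ← Finset.mul_sum]
  rw [← h]
  simp only [one_succAbove_succ, one_succAbove_one, one_succAbove_zero,
    Fin.succ_zero_eq_one, Fin.succ_one_eq_two]
  ring

/-- Adding a coboundary to the cup product of a weighted count with a cocycle `κ` turns it into
the coboundary of a weighted count with weights read off from `κ`. -/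
theorem cup_add_cob_eq {τ : Type*} {m : ℕ} (T : W → W → Finset τ) (a : τ → W)
    {κ : (Fin (m + 2) → W) → ℝ} (hκ : cob κ = 0) (x : Fin (m + 3) → W) :
    (((T (x 0) (x 1)).card : ℝ) - (T (x 1) (x 0)).card) * κ (fun i => x i.succ) +
      cob (fun y : Fin (m + 2) → W =>
        weightedCount T (fun t => κ (Fin.cons (a t) fun i => y i.succ)) (y 0) (y 1)) x =
      d1 (weightedCount T fun t => κ (Fin.cons (a t) fun i => x i.succ.succ))
        (x 0) (x 1) (x 2) := by
  have hcoc : ∀ t, κ (fun i => x i.succ) = κ (Fin.cons (a t) fun i => x i.succ.succ) -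
      ∑ k : Fin (m + 1), (-1) ^ (k : ℕ) *
        κ (Fin.cons (a t) fun i => x (k.succ.succAbove i).succ) := by
    intro t
    have h := congrFun hκ (Fin.cons (a t) fun i => x i.succ)
    have hc : ∀ k : Fin (m + 2), (fun i => (Fin.cons (a t) fun i => x i.succ : Fin (m + 3) → W)
        (k.succ.succAbove i)) = Fin.cons (a t) fun i => x (k.succAbove i).succ := by
      intro k
      funext i
      refine Fin.cases ?_ (fun i => ?_) i
      · simp
      · simp [Fin.succ_succAbove_succ]
    rw [cob_eq_sub_sum, Fin.sum_univ_succ] at h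
    simp only [hc, Fin.cons_succ, Pi.zero_apply, Fin.val_zero, pow_zero, one_mul,
      Fin.succAbove_zero, Fin.val_succ, pow_succ, mul_neg, mul_one, neg_mul,
      Finset.sum_neg_distrib] at h
    linarith
  rw [← weightedCount_const]
  have hw : weightedCount T (fun _ => κ fun i => x i.succ) (x 0) (x 1) = _ :=
    (congrArg (fun w => weightedCount T w (x 0) (x 1)) (funext hcoc)).trans
      (weightedCount_sub_sum T _ _ _ _ _)
  rw [hw, cob_eq_sub_add_sum, d1]
  simp only [one_succAbove_succ, one_succAbove_one, one_succAbove_zero, succ_succ_succAbove_one,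
    Fin.succ_zero_eq_one, Fin.succ_one_eq_two, Fin.succ_succAbove_zero,
    Fin.succ_succAbove_succ]
  ring

end Cochain

/-- Theorem `thm:mainccc`: on a median graph of dimension at most `D`
and staircase length at most `σ` with a group action by graph automorphisms, if `s` is
an H-segment of length `l ≥ 1`, `n ≥ 1`, and `κ` is a bounded Γ-invariant cocycle on
`V^{n+1}` that is non-transverse to the orbit `Γs`, then `(δ¹f_s) ∪ κ` has a bounded
Γ-invariant primitive; i.e. `[δ¹f_s] ∪ [κ] = 0` in degree-(n+2) equivariant bounded
cohomology. -/
theorem statement2 {V : Type*} (X : SimpleGraph V) (D σ : ℕ)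
    (hmed : IsMedianGraph X) (hdim : DimLE X D) (hstair : StaircaseLE X σ)
    (Γ : Type*) [Group Γ] [MulAction Γ V] (hact : ActsOn Γ X)
    (l : ℕ) (hl : 1 ≤ l) (s : Fin l → Set V) (hseg : IsHSegment X l s)
    (n : ℕ) (hn : 1 ≤ n) (κ : (Fin (n + 1) → V) → ℝ)
    (hκb : IsBounded κ) (hκinv : IsInvariant Γ κ)
    (hκcoc : cob κ = 0)
    (hκnt : ∀ γ : Γ, NonTransverseTo X hl κ (segSMul γ s)) :
    ∃ β : (Fin (n + 2) → V) → ℝ, IsBounded β ∧ IsInvariant Γ β ∧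
      ∀ x : Fin (n + 3) → V,
        cob β x =
          d1 (fs X Γ s) (x 0) (x 1) (x 2) *
            κ (fun i => x ⟨2 + (i : ℕ), by have := i.isLt; omega⟩) := by
  classical
  obtain ⟨m, rfl⟩ : ∃ m, n = m + 1 := ⟨n - 1, by omega⟩
  have hconn := hmed.1
  have hne : Nonempty V := hconn.nonempty
  have hhead : ∀ t : Fin l → Set V, ∃ a, (∃ γ : Γ, t = segSMul γ s) → IsHead X hl t a := by
    intro t
    by_cases ht : ∃ γ : Γ, t = segSMul γ s
    · obtain ⟨γ, rfl⟩ := ht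
      obtain ⟨a, ha⟩ := (hseg.segSMul hact hconn γ).exists_isHead hl
      exact ⟨a, fun _ => ha⟩
    · exact ⟨hne.some, fun h => absurd h ht⟩
  choose a ha using hhead
  let T : V → V → Finset (Fin l → Set V) := fun x y =>
    (hmed.finite_translatesIn (Γ := Γ) s x y).toFinset
  have hsum : ∀ (γ : Γ) (z : Fin (m + 1) → V) (x y : V),
      ∑ t ∈ T (γ • x) (γ • y), κ (Fin.cons (a t) fun i => γ • z i) =
        ∑ t ∈ T x y, κ (Fin.cons (a t) z) := by
    intro γ z x y
    refine sum_translatesIn_smul hmed hact γ x y ?_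
    rintro t ⟨⟨δ, rfl⟩, -⟩
    rw [← hκinv γ (Fin.cons _ z)]
    have hcons : (fun i => γ • (Fin.cons (a (segSMul δ s)) z : Fin (m + 2) → V) i) =
        Fin.cons (γ • a (segSMul δ s)) fun i => γ • z i := by
      funext i
      exact Fin.cases rfl (fun _ => rfl) i
    rw [hcons]
    have h₁ := (ha _ ⟨δ, rfl⟩).smul hact hconn γ
    have h₂ := ha _ ⟨γ * δ, segSMul_segSMul γ δ s⟩
    rw [segSMul_segSMul] at h₁ h₂ ⊢
    exact (hκnt (γ * δ)).1 _ _ _ h₂ h₁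
  let η : (Fin (m + 2) → V) → ℝ := fun y =>
    weightedCount T (fun t => κ (Fin.cons (a t) fun i => y i.succ)) (y 0) (y 1)
  have hη : IsInvariant Γ η := fun γ y => by
    simp only [η, weightedCount, hsum]
  have hfs : ∀ x y, fs X Γ s x y = ((T x y).card : ℝ) - (T y x).card := fun x y => by
    simp only [fs, T, Set.ncard_eq_toFinset_card _ (hmed.finite_translatesIn s _ _)]
  have hfsinv : ∀ (γ : Γ) (x y : V), fs X Γ s (γ • x) (γ • y) = fs X Γ s x y := by
    have hcard : ∀ (γ : Γ) (x y : V), ((T (γ • x) (γ • y)).card : ℝ) = (T x y).card := by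
      intro γ x y
      simpa [T] using sum_translatesIn_smul hmed hact (s := s) γ x y (w := fun _ => 1)
        (w' := fun _ => 1) fun _ _ => rfl
    intro γ x y
    rw [hfs, hfs, hcard, hcard]
  let φ : (Fin (m + 3) → V) → ℝ := fun x => fs X Γ s (x 0) (x 1) * κ fun i => x i.succ
  refine ⟨fun x => φ x + cob η x, ?_, fun γ x => ?_, fun x => ?_⟩
  · obtain ⟨K, hK⟩ := hκb
    obtain ⟨C, hC⟩ := exists_translatesIn_split hmed hdim hstair hact hl hseg
    refine ⟨6 * (C * K), fun x => ?_⟩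
    have hK0 : 0 ≤ K := (abs_nonneg _).trans (hK fun _ => hne.some)
    have h := cup_add_cob_eq T a hκcoc x
    rw [← hfs] at h
    refine (congrArg abs h).trans_le ?_
    exact abs_d1_weightedCount_le hmed T hC hK0 (fun t => hK _) _ _ _
  · simp only [φ]
    rw [hη.cob γ x, hfsinv, hκinv γ fun i => x i.succ]
  · have h₁ : cob (fun x => φ x + cob η x) x = cob φ x + cob (cob η) x := by
      simp only [cob, mul_add, Finset.sum_add_distrib]
    rw [h₁, cob_cob, Pi.zero_apply, add_zero, cob_cup _ hκcoc]
    congr 2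
    funext i
    congr 1
    ext
    simp only [Fin.val_succ]
    omega

end MedianQM
end
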